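/- arXiv:1009.2974 — 3 statements merged into one kernel-verified Lean document; each statement's English description precedes it below -/
import Mathlib

section
/- Let γ > 2 be a real number. Then there exists δ > 0 such that for all real numbers a ≥ 0, b ≥ 0 and every k with 0 ≤ k ≤ 1, one has (γ − 1)·a^γ + b^γ − γ·a^(γ−1)·k·b ≥ δ·|a − b|^γ. -/
/-- The graph of `x ↦ x ^ p`, `p > 1`, lies above its tangent at `a`. -/
theorem Real.rpow_tangent_le {p a b : ℝ} (hp : 1 < p) (ha : 0 ≤ a) (hb : 0 ≤ b) :
    a ^ p + p * a ^ (p - 1) * (b - a) ≤ b ^ p := by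
  rcases ha.eq_or_lt with rfl | ha
  · rw [Real.zero_rpow (by linarith), Real.zero_rpow (by linarith)]
    simpa using Real.rpow_nonneg hb p
  · have hs : -1 ≤ b / a - 1 := by linarith [div_nonneg hb ha.le]
    have h := one_add_mul_self_le_rpow_one_add hs hp.le
    rw [add_sub_cancel, Real.div_rpow hb ha.le, le_div_iff₀ (Real.rpow_pos_of_pos ha p)] at h
    have hap : a ^ p = a ^ (p - 1) * a := by
      rw [← Real.rpow_add_one ha.ne', sub_add_cancel]
    calc a ^ p + p * a ^ (p - 1) * (b - a) = (1 + p * (b / a - 1)) * a ^ p := by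
          rw [hap]; field_simp
      _ ≤ b ^ p := h

/-- The remainder of the tangent at `a` to `x ↦ x ^ γ`, `γ > 2`, dominates `|x - a| ^ γ`. -/
theorem Real.abs_sub_rpow_le_tangent_remainder {γ a b : ℝ} (hγ : 2 < γ) (ha : 0 ≤ a)
    (hb : 0 ≤ b) :
    |a - b| ^ γ ≤ (γ - 1) * a ^ γ + b ^ γ - γ * a ^ (γ - 1) * b := by
  have split (x : ℝ) (hx : 0 ≤ x) : x ^ γ = x ^ (γ - 2) * x ^ 2 := by
    rw [← Real.rpow_add_natCast' hx (by push_cast; linarith)]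
    norm_num
  have split_one (x : ℝ) (hx : 0 ≤ x) (q : ℝ) (hq : 1 < q) : x ^ q = x ^ (q - 1) * x := by
    rw [← Real.rpow_add_one' hx (by linarith), sub_add_cancel]
  have hA : a ^ (γ - 1) = a ^ (γ - 2) * a := by
    rw [split_one a ha (γ - 1) (by linarith)]
    ring_nf
  have hA0 : 0 ≤ a ^ (γ - 2) := Real.rpow_nonneg ha _
  rcases le_total b a with hba | hab
  · have hd : 0 ≤ a - b := by linarith
    have h₁ : (a - b) ^ γ ≤ a ^ (γ - 2) * (a - b) ^ 2 := by
      rw [split _ hd]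
      gcongr
      linarith
    have h₂ := mul_le_mul_of_nonneg_left
      (Real.rpow_tangent_le (p := γ - 1) (by linarith) ha hb) hb
    rw [show γ - 1 - 1 = γ - 2 by ring, hA] at h₂
    rw [abs_of_nonneg hd, split a ha, split_one b hb γ (by linarith), hA]
    have h₃ : 0 ≤ a ^ (γ - 2) * ((γ - 2) * (a - b) ^ 2) :=
      mul_nonneg hA0 (mul_nonneg (by linarith) (sq_nonneg _))
    linarith
  · have hd : 0 ≤ b - a := by linarith
    have sq_rpow (x : ℝ) (hx : 0 ≤ x) (q : ℝ) : (x ^ 2) ^ (q / 2) = x ^ q := by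
      rw [← Real.rpow_natCast, ← Real.rpow_mul hx]
      congr 1
      push_cast
      ring
    have hc : 0 ≤ a ^ 2 + 2 * a * (b - a) := by positivity
    have h₁ := Real.add_rpow_le_rpow_add (p := γ / 2) hc (sq_nonneg (b - a)) (by linarith)
    have h₂ := Real.rpow_tangent_le (p := γ / 2) (by linarith) (sq_nonneg a) hc
    rw [show a ^ 2 + 2 * a * (b - a) + (b - a) ^ 2 = b ^ 2 by ring, sq_rpow _ hd,
      sq_rpow _ hb] at h₁
    rw [show γ / 2 - 1 = (γ - 2) / 2 by ring, sq_rpow _ ha, sq_rpow _ ha] at h₂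
    rw [abs_sub_comm, abs_of_nonneg hd, hA]
    have := split a ha
    nlinarith

theorem young_type_cutoff_coercive (γ : ℝ) (hγ : 2 < γ) :
    ∃ δ : ℝ, 0 < δ ∧ ∀ a b k : ℝ, 0 ≤ a → 0 ≤ b → 0 ≤ k → k ≤ 1 →
      (γ - 1) * a ^ γ + b ^ γ - γ * a ^ (γ - 1) * k * b ≥ δ * |a - b| ^ γ := by
  refine ⟨1, one_pos, fun a b k ha hb _ hk => ?_⟩
  have h := Real.abs_sub_rpow_le_tangent_remainder hγ ha hb
  have hm : 0 ≤ γ * a ^ (γ - 1) * b :=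
    mul_nonneg (mul_nonneg (by linarith) (Real.rpow_nonneg ha _)) hb
  have := mul_le_mul_of_nonneg_left hk hm
  linarith
end

section
/- Let d ≥ 1, equip ℝ^d with Lebesgue measure, and let Φ : ℝ → ℝ be a convex continuous function. Let f_n : ℝ^d → ℝ be a sequence of measurable functions and f, g : ℝ^d → ℝ measurable functions such that f_n, Φ∘f_n, f, g are all integrable on every closed ball, and such that for every closed ball B ⊆ ℝ^d one has ∫_B f_n → ∫_B f and ∫_B (Φ∘f_n) → ∫_B g as n → ∞. Then Φ(f(x)) ≤ g(x) for almost every x ∈ ℝ^d. -/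
open MeasureTheory Filter Topology

/-- A function which is integrable on all closed balls is locally integrable. -/
theorem locallyIntegrable_of_integrableOn_closedBall {X E : Type*} [PseudoMetricSpace X]
    [MeasurableSpace X] [NormedAddCommGroup E] {μ : Measure X} {f : X → E}
    (hf : ∀ c r, IntegrableOn f (Metric.closedBall c r) μ) : LocallyIntegrable f μ :=
  fun x => ⟨Metric.closedBall x 1, Metric.closedBall_mem_nhds x one_pos, hf x 1⟩

/-- Jensen's inequality on a fixed set passes to the limit of the integrals over that set. -/
theorem map_setAverage_le_of_tendsto_setIntegral {X : Type*} [MeasurableSpace X] {μ : Measure X}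
    {s : Set X} (hs₀ : μ s ≠ 0) (hs : μ s ≠ ⊤) {Φ : ℝ → ℝ} (hΦ : ConvexOn ℝ Set.univ Φ)
    (hΦc : Continuous Φ) {f : ℕ → X → ℝ} {F g : X → ℝ} (hf : ∀ n, IntegrableOn (f n) s μ)
    (hΦf : ∀ n, IntegrableOn (fun x => Φ (f n x)) s μ)
    (hF : Tendsto (fun n => ∫ x in s, f n x ∂μ) atTop (𝓝 (∫ x in s, F x ∂μ)))
    (hg : Tendsto (fun n => ∫ x in s, Φ (f n x) ∂μ) atTop (𝓝 (∫ x in s, g x ∂μ))) :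
    Φ (⨍ x in s, F x ∂μ) ≤ ⨍ x in s, g x ∂μ := by
  simp only [setAverage_eq]
  refine le_of_tendsto_of_tendsto' ((hΦc.tendsto _).comp (hF.const_smul _)) (hg.const_smul _)
    fun n => ?_
  have key := hΦ.map_set_average_le hΦc.continuousOn isClosed_univ hs₀ hs
    (ae_of_all _ fun _ => Set.mem_univ _) (hf n) (hΦf n)
  simpa only [setAverage_eq, Function.comp_apply] using key

theorem convex_weak_limit_principle (d : ℕ) (hd : 1 ≤ d)
    (Φ : ℝ → ℝ) (hΦconv : ConvexOn ℝ Set.univ Φ) (hΦcont : Continuous Φ)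
    (f : ℕ → EuclideanSpace ℝ (Fin d) → ℝ) (F g : EuclideanSpace ℝ (Fin d) → ℝ)
    (hfm : ∀ n, Measurable (f n)) (hFm : Measurable F) (hgm : Measurable g)
    (hfint : ∀ n c r, IntegrableOn (f n) (Metric.closedBall c r) volume)
    (hΦfint : ∀ n c r, IntegrableOn (fun x => Φ (f n x)) (Metric.closedBall c r) volume)
    (hFint : ∀ c r, IntegrableOn F (Metric.closedBall c r) volume)
    (hgint : ∀ c r, IntegrableOn g (Metric.closedBall c r) volume)
    (h1 : ∀ c r, Tendsto (fun n => ∫ x in Metric.closedBall c r, f n x) atTop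
      (𝓝 (∫ x in Metric.closedBall c r, F x)))
    (h2 : ∀ c r, Tendsto (fun n => ∫ x in Metric.closedBall c r, Φ (f n x)) atTop
      (𝓝 (∫ x in Metric.closedBall c r, g x))) :
    ∀ᵐ x ∂(volume : Measure (EuclideanSpace ℝ (Fin d))), Φ (F x) ≤ g x := by
  filter_upwards [
    IsUnifLocDoublingMeasure.ae_tendsto_average volume
      (locallyIntegrable_of_integrableOn_closedBall hFint) 1,
    IsUnifLocDoublingMeasure.ae_tendsto_average volume
      (locallyIntegrable_of_integrableOn_closedBall hgint) 1] with x hFx hgx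
  have hmem : ∀ᶠ r : ℝ in 𝓝[>] 0, x ∈ Metric.closedBall x (1 * r) := by
    filter_upwards [self_mem_nhdsWithin] with r hr
    exact Metric.mem_closedBall_self (by simpa using le_of_lt hr)
  refine le_of_tendsto_of_tendsto
    ((hΦcont.tendsto _).comp (hFx (fun _ => x) id tendsto_id hmem))
    (hgx (fun _ => x) id tendsto_id hmem) ?_
  filter_upwards [self_mem_nhdsWithin] with r hr
  exact map_setAverage_le_of_tendsto_setIntegral (Metric.measure_closedBall_pos volume x hr).ne'
    measure_closedBall_lt_top.ne hΦconv hΦcont (fun n => hfint n x r) (fun n => hΦfint n x r)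
    (h1 x r) (h2 x r)
end

section
/- Let d ≥ 1, equip ℝ^d with Lebesgue measure, and let γ > 1 be a real number. Let f_n : ℝ^d → ℝ be a sequence of nonnegative measurable functions and f, g, h : ℝ^d → ℝ measurable functions, all integrable on ℝ^d (with f_n^γ, f_n^{γ+1} also integrable), such that for every closed ball B ⊆ ℝ^d one has ∫_B f_n → ∫_B f, ∫_B f_n^γ → ∫_B g, and ∫_B f_n^{γ+1} → ∫_B h as n → ∞. If moreover f·g is integrable and ∫_{ℝ^d} f·g ≥ ∫_{ℝ^d} h, then g(x) = f(x)^γ for almost every x ∈ ℝ^d. -/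
open MeasureTheory Filter Topology

/-- A locally integrable function whose integral over every closed ball is nonnegative is
nonnegative almost everywhere. -/
theorem ae_nonneg_of_forall_setIntegral_closedBall_nonneg {E : Type*} [MetricSpace E]
    [MeasurableSpace E] [BorelSpace E] [SecondCountableTopology E] [HasBesicovitchCovering E]
    {μ : Measure E} [IsLocallyFiniteMeasure μ] {φ : E → ℝ} (hφ : LocallyIntegrable φ μ)
    (h : ∀ c r, 0 ≤ ∫ x in Metric.closedBall c r, φ x ∂μ) : ∀ᵐ x ∂μ, 0 ≤ φ x := by
  filter_upwards [(Besicovitch.vitaliFamily μ).ae_tendsto_average hφ] with x hx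
  refine ge_of_tendsto' (hx.comp (Besicovitch.tendsto_filterAt μ x)) fun r => ?_
  simp only [Function.comp_apply, setAverage_eq]
  exact smul_nonneg (by positivity) (h x r)

theorem Real.sub_mul_rpow_sub_rpow_nonneg {s a γ : ℝ} (hs : 0 ≤ s) (ha : 0 ≤ a) (hγ : 0 < γ) :
    0 ≤ s ^ (γ + 1) - a * s ^ γ - a ^ γ * s + a ^ γ * a := by
  have e : s ^ (γ + 1) = s ^ γ * s := by
    rw [Real.rpow_add_one' hs (by linarith)]
  have : 0 ≤ (s - a) * (s ^ γ - a ^ γ) := by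
    rcases le_total s a with h | h
    · exact mul_nonneg_of_nonpos_of_nonpos (by linarith)
        (sub_nonpos.2 (Real.rpow_le_rpow hs h hγ.le))
    · exact mul_nonneg (by linarith) (sub_nonneg.2 (Real.rpow_le_rpow ha h hγ.le))
  rw [e]; linarith

/-- The graph of `a ↦ a ^ γ` on `[0, ∞)` is maximal monotone (Minty's trick). -/
theorem Real.eq_rpow_of_forall_sub_mul_sub_rpow_nonneg {u v γ : ℝ} (hu : 0 ≤ u) (hv : 0 ≤ v)
    (hγ : 0 < γ) (h : ∀ a, 0 ≤ a → 0 ≤ (u - a) * (v - a ^ γ)) : v = u ^ γ := by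
  have hc : ContinuousAt (fun a : ℝ => a ^ γ) u :=
    (Real.continuous_rpow_const hγ.le).continuousAt
  apply le_antisymm
  · refine ge_of_tendsto (hc.tendsto.mono_left (nhdsWithin_le_nhds (s := Set.Ioi u))) ?_
    filter_upwards [self_mem_nhdsWithin] with a (ha : u < a)
    nlinarith [h a (by linarith)]
  · rcases hu.eq_or_lt with rfl | hu'
    · simpa [Real.zero_rpow hγ.ne'] using hv
    · refine le_of_tendsto (hc.tendsto.mono_left (nhdsWithin_le_nhds (s := Set.Iio u))) ?_
      filter_upwards [self_mem_nhdsWithin, nhdsWithin_le_nhds (lt_mem_nhds hu')]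
        with a (ha : a < u) ha'
      nlinarith [h a ha'.le]

theorem pressure_identification (d : ℕ) (hd : 1 ≤ d) (γ : ℝ) (hγ : 1 < γ)
    (f : ℕ → EuclideanSpace ℝ (Fin d) → ℝ)
    (F g h : EuclideanSpace ℝ (Fin d) → ℝ)
    (hfm : ∀ n, Measurable (f n)) (hf0 : ∀ n x, 0 ≤ f n x)
    (hFm : Measurable F) (hgm : Measurable g) (hhm : Measurable h)
    (hfint : ∀ n, Integrable (f n) volume)
    (hfγint : ∀ n, Integrable (fun x => f n x ^ γ) volume)
    (hfγ1int : ∀ n, Integrable (fun x => f n x ^ (γ + 1)) volume)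
    (hFint : Integrable F volume) (hgint : Integrable g volume)
    (hhint : Integrable h volume)
    (h1 : ∀ c r, Tendsto (fun n => ∫ x in Metric.closedBall c r, f n x) atTop
      (𝓝 (∫ x in Metric.closedBall c r, F x)))
    (h2 : ∀ c r, Tendsto (fun n => ∫ x in Metric.closedBall c r, f n x ^ γ) atTop
      (𝓝 (∫ x in Metric.closedBall c r, g x)))
    (h3 : ∀ c r, Tendsto (fun n => ∫ x in Metric.closedBall c r, f n x ^ (γ + 1)) atTop
      (𝓝 (∫ x in Metric.closedBall c r, h x)))
    (hFgint : Integrable (fun x => F x * g x) volume)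
    (hineq : ∫ x, F x * g x ≥ ∫ x, h x) :
    ∀ᵐ x ∂(volume : Measure (EuclideanSpace ℝ (Fin d))), g x = F x ^ γ := by
  have hγ0 : 0 < γ := by linarith
  have hF0 : ∀ᵐ x, 0 ≤ F x :=
    ae_nonneg_of_forall_setIntegral_closedBall_nonneg hFint.locallyIntegrable fun c r =>
      ge_of_tendsto' (h1 c r) fun n => integral_nonneg fun x => hf0 n x
  have hg0 : ∀ᵐ x, 0 ≤ g x :=
    ae_nonneg_of_forall_setIntegral_closedBall_nonneg hgint.locallyIntegrable fun c r =>
      ge_of_tendsto' (h2 c r) fun n => integral_nonneg fun x => Real.rpow_nonneg (hf0 n x) _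
  have key : ∀ a : ℝ, 0 ≤ a → ∀ᵐ x, 0 ≤ h x - a * g x - a ^ γ * F x + a ^ γ * a := by
    intro a ha
    have expand : ∀ (u v w : EuclideanSpace ℝ (Fin d) → ℝ), Integrable u → Integrable v →
        Integrable w → ∀ c r,
        ∫ x in Metric.closedBall c r, (w x - a * v x - a ^ γ * u x + a ^ γ * a) =
          (∫ x in Metric.closedBall c r, w x) - a * (∫ x in Metric.closedBall c r, v x)
            - a ^ γ * (∫ x in Metric.closedBall c r, u x)
            + ∫ _ in Metric.closedBall c r, a ^ γ * a := by
      intro u v w hu hv hw c r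
      have hu' := (hu.const_mul (a ^ γ)).integrableOn (s := Metric.closedBall c r)
      have hv' := (hv.const_mul a).integrableOn (s := Metric.closedBall c r)
      have hw' := hw.integrableOn (s := Metric.closedBall c r)
      have hwv : IntegrableOn (fun x => w x - a * v x) (Metric.closedBall c r) := hw'.sub hv'
      have hwvu : IntegrableOn (fun x => w x - a * v x - a ^ γ * u x) (Metric.closedBall c r) :=
        hwv.sub hu'
      rw [integral_add hwvu (integrableOn_const measure_closedBall_lt_top.ne),
        integral_sub hwv hu', integral_sub hw' hv', integral_const_mul,
        integral_const_mul]
    refine ae_nonneg_of_forall_setIntegral_closedBall_nonneg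
      (((hhint.sub (hgint.const_mul a)).sub (hFint.const_mul (a ^ γ))).locallyIntegrable.add
        (locallyIntegrable_const _)) fun c r => ?_
    rw [expand F g h hFint hgint hhint]
    refine ge_of_tendsto' ((((h3 c r).sub ((h2 c r).const_mul a)).sub
      ((h1 c r).const_mul (a ^ γ))).add_const _) fun n => ?_
    rw [← expand _ _ _ (hfint n) (hfγint n) (hfγ1int n)]
    exact integral_nonneg fun x => Real.sub_mul_rpow_sub_rpow_nonneg (hf0 n x) ha hγ0
  have key_all : ∀ᵐ x, ∀ a : ℝ, 0 ≤ a → 0 ≤ h x - a * g x - a ^ γ * F x + a ^ γ * a := by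
    filter_upwards [ae_all_iff.2 fun q : ℚ => key |(q : ℝ)| (abs_nonneg _)] with x hx a ha
    have hcont : Continuous fun a : ℝ =>
        h x - |a| * g x - |a| ^ γ * F x + |a| ^ γ * |a| := by
      have := continuous_abs.rpow_const (p := γ) fun _ : ℝ => Or.inr hγ0.le
      fun_prop
    have := (Rat.denseRange_cast (𝕜 := ℝ)).induction_on
      (p := fun a : ℝ => 0 ≤ h x - |a| * g x - |a| ^ γ * F x + |a| ^ γ * |a|)
      a (isClosed_le continuous_const hcont) hx
    simpa only [abs_of_nonneg ha] using this
  have hle : (fun x => F x * g x) ≤ᵐ[volume] h := by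
    filter_upwards [key_all, hF0] with x hx hFx
    linarith [hx (F x) hFx]
  have heq : (fun x => F x * g x) =ᵐ[volume] h :=
    (integral_eq_iff_of_ae_le hFgint hhint hle).1
      (le_antisymm (integral_mono_ae hFgint hhint hle) hineq)
  filter_upwards [key_all, hF0, hg0, heq] with x hx hFx hgx hex
  refine Real.eq_rpow_of_forall_sub_mul_sub_rpow_nonneg hFx hgx hγ0 fun a ha => ?_
  linarith [hx a ha]
end
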